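/- Let α be a ≐-class of possible singleton processes with irreversibility value 𝕀(α) (as given by the Dedekind-cut construction relative to a bit process Θ_b), and let Γ be the ≐-class of an information process (I, J), with 𝕀(Γ) = log₂|J| − log₂|I|. Then the combined process α + Γ is natural if and only if 𝕀(α) + 𝕀(Γ) ≥ 0. -/

import Mathlib

structure EidoSys where
  State : Type
  [decEq : DecidableEq State]
  Eido : Set (Finset State)
  pair : State → State → State
  Sim : Finset State → Finset State → Prop
  Arrow : Finset State → Finset State → Prop
  pair_inj : ∀ a b a' b', pair a b = pair a' b' → a = a' ∧ b = b'
  eido_nonempty : ∀ A ∈ Eido, A.Nonempty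
  singleton_mem : ∀ a : State, ({a} : Finset State) ∈ Eido
  comb_mem : ∀ A B : Finset State, Finset.image₂ pair A B ∈ Eido ↔ A ∈ Eido ∧ B ∈ Eido
  subset_mem : ∀ A B : Finset State, A ∈ Eido → B ⊆ A → B.Nonempty → B ∈ Eido
  sim_refl : ∀ A : Finset State, Sim A A
  sim_symm : ∀ A B : Finset State, Sim A B → Sim B A
  sim_trans : ∀ A B C : Finset State, Sim A B → Sim B C → Sim A C
  sim_comm : ∀ A B : Finset State, Sim (Finset.image₂ pair A B) (Finset.image₂ pair B A)
  sim_assoc : ∀ A B C : Finset State,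
    Sim (Finset.image₂ pair (Finset.image₂ pair A B) C) (Finset.image₂ pair A (Finset.image₂ pair B C))
  sim_congr : ∀ A B C : Finset State, Sim A B → Sim (Finset.image₂ pair A C) (Finset.image₂ pair B C)
  arrow_of_sim : ∀ A B : Finset State, A ∈ Eido → B ∈ Eido → Sim A B → Arrow A B
  arrow_trans : ∀ A B C : Finset State, Arrow A B → Arrow B C → Arrow A C
  arrow_comb : ∀ A B C : Finset State, Arrow A B → Arrow (Finset.image₂ pair A C) (Finset.image₂ pair B C)
  arrow_cancel : ∀ (A B : Finset State) (s : State),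
    Arrow (Finset.image₂ pair A {s}) (Finset.image₂ pair B {s}) → Arrow A B
  arrow_nsubset : ∀ A B : Finset State, A ∈ Eido → B ∈ Eido → B ⊂ A → ¬ Arrow A B
  arrow_subset_single : ∀ (A A' : Finset State) (b : State),
    A ∈ Eido → A' ⊆ A → A'.Nonempty → Arrow A {b} → Arrow A' {b}
  arrow_union : ∀ A₁ A₂ B₁ B₂ : Finset State,
    A₁ ∈ Eido → A₂ ∈ Eido → B₁ ∈ Eido → B₂ ∈ Eido →
    Disjoint A₁ A₂ → Disjoint B₁ B₂ →
    (∀ a ∈ A₁ ∪ A₂, ∀ b ∈ A₁ ∪ A₂, Arrow {a} {b} ∨ Arrow {b} {a}) →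
    (∀ a ∈ B₁ ∪ B₂, ∀ b ∈ B₁ ∪ B₂, Arrow {a} {b} ∨ Arrow {b} {a}) →
    Arrow A₁ B₁ → Arrow A₂ B₂ → Arrow (A₁ ∪ A₂) (B₁ ∪ B₂)

attribute [instance] EidoSys.decEq

namespace EidoSys

variable (S : EidoSys)

/-- Combination of eidostates: the Cartesian product, realized via the pairing map. -/
def comb (A B : Finset S.State) : Finset S.State := Finset.image₂ S.pair A B

/-- The process (A,B) is possible: A ⇌ B. -/
def Pos (A B : Finset S.State) : Prop := S.Arrow A B ∨ S.Arrow B A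

/-- A ↔ B. -/
def Rev (A B : Finset S.State) : Prop := S.Arrow A B ∧ S.Arrow B A

/-- Uniform eidostate. -/
def Uniform (A : Finset S.State) : Prop := A ∈ S.Eido ∧ ∀ a ∈ A, ∀ b ∈ A, S.Pos {a} {b}

/-- Record state: a ↔ a + r for some state a. -/
def IsRecord (r : S.State) : Prop := ∃ a : S.State, S.Rev {a} (S.comb {a} {r})

/-- Information state: an eidostate all of whose elements are record states. -/
def IsInfo (I : Finset S.State) : Prop := I ∈ S.Eido ∧ ∀ r ∈ I, S.IsRecord r

/-- Bit state: an information state with exactly two elements. -/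
def IsBit (I : Finset S.State) : Prop := S.IsInfo I ∧ I.card = 2

/-- Information axiom: there exist a bit state and a possible bit process. -/
def InfoAxiom : Prop := ∃ (r : S.State) (I : Finset S.State), S.IsRecord r ∧ S.IsBit I ∧ S.Pos {r} I

/-- Demon axiom. -/
def DemonAxiom : Prop := ∀ a b : S.State, ∀ J : Finset S.State, S.IsInfo J →
    S.Arrow {a} (S.comb {b} J) →
    (∃ I : Finset S.State, S.IsInfo I ∧ S.Arrow {b} (S.comb {a} I)) ∧
    (∀ I : Finset S.State, S.IsInfo I → S.Arrow {a} (S.comb {b} I) ∨ S.Arrow (S.comb {b} I) {a})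

/-- `copies A n` is the combination of `n+1` copies of `A` (so `copies A 0 = A`). -/
def copies (A : Finset S.State) : ℕ → Finset S.State
  | 0 => A
  | n + 1 => S.comb A (copies A n)

/-- Stability axiom: if nA → nB + J for arbitrarily large n, then A → B. -/
def StabilityAxiom : Prop := ∀ A B J : Finset S.State, A ∈ S.Eido → B ∈ S.Eido → S.IsInfo J →
    (∀ N : ℕ, ∃ n ≥ N, S.Arrow (S.copies A n) (S.comb (S.copies B n) J)) → S.Arrow A B

/-- State-equivalence axiom. -/
def StateEquivAxiom : Prop := ∀ E : Finset S.State, S.Uniform E →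
    ∃ e x y : S.State, S.Arrow {x} {y} ∧ S.Rev (S.comb E {x}) (S.comb {e} {y})

/-- `addCopies A B k` is A + k·B (k copies of B appended to A). -/
def addCopies (A B : Finset S.State) : ℕ → Finset S.State
  | 0 => A
  | k + 1 => S.comb (addCopies A B k) B

/-- A designated set of mechanical states. -/
def MechSet (M : Set S.State) : Prop :=
  (∀ l ∈ M, ∀ m ∈ M, S.pair l m ∈ M) ∧
  (∀ l ∈ M, ∀ m ∈ M, S.Arrow {l} {m} → S.Arrow {m} {l})

/-- Component of content on uniform eidostates. -/
def IsCoCU (Q : Finset S.State → ℝ) : Prop :=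
  (∀ E F : Finset S.State, S.Uniform E → S.Uniform F → Q (S.comb E F) = Q E + Q F) ∧
  (∀ E F : Finset S.State, S.Uniform E → S.Uniform F → S.Pos E F → Q E = Q F)

/-- Entropy function on the uniform eidostates (relative to mechanical states M). -/
def IsEntropyU (M : Set S.State) (Ent : Finset S.State → ℝ) : Prop :=
  (∀ E F : Finset S.State, S.Uniform E → S.Uniform F → Ent (S.comb E F) = Ent E + Ent F) ∧
  (∀ E F : Finset S.State, S.Uniform E → S.Uniform F → S.Pos E F → (S.Arrow E F ↔ Ent E ≤ Ent F)) ∧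
  (∀ m ∈ M, Ent {m} = 0) ∧
  (∀ I : Finset S.State, S.IsInfo I → Ent I = Real.logb 2 (I.card))

end EidoSys

namespace EidoSys

variable (S : EidoSys)

/-- A formal process: an ordered pair of eidostates. -/
abbrev Proc := Finset S.State × Finset S.State

/-- Sum of formal processes. -/
def psum (p q : S.Proc) : S.Proc := (S.comb p.1 q.1, S.comb p.2 q.2)

/-- Negation of a formal process. -/
def pneg (p : S.Proc) : S.Proc := (p.2, p.1)

/-- The equivalence ≐ of formal processes: (A,B) ≐ (C,D) iff there are states x, y with
A + x ∼ C + y and B + x ∼ D + y. -/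
def Peq (p q : S.Proc) : Prop :=
  ∃ x y : S.State, S.Sim (S.comb p.1 {x}) (S.comb q.1 {y}) ∧ S.Sim (S.comb p.2 {x}) (S.comb q.2 {y})

/-- An irreversibility function on a ≐-saturated collection P of possible processes
(representing a collection of ≐-classes): a ≐-invariant, additive real function whose sign
determines the type of each process. -/
def IsIrrevFn (P : Set S.Proc) (I : S.Proc → ℝ) : Prop :=
  (∀ p ∈ P, ∀ q ∈ P, S.Peq p q → I p = I q) ∧
  (∀ p ∈ P, ∀ q ∈ P, I (S.psum p q) = I p + I q) ∧
  (∀ p ∈ P, S.Arrow p.1 p.2 → ¬ S.Arrow p.2 p.1 → 0 < I p) ∧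
  (∀ p ∈ P, S.Arrow p.1 p.2 → S.Arrow p.2 p.1 → I p = 0) ∧
  (∀ p ∈ P, S.Arrow p.2 p.1 → ¬ S.Arrow p.1 p.2 → I p < 0)

end EidoSys

namespace EidoSys

variable (S : EidoSys)

/-- The formal process qα − pΘ_b, where α = (A, B) (with q ≥ 1 copies, `copies X (q-1)`),
Θ_b = ({r}, Ib) is a bit process, and p ∈ ℤ (negative p meaning |p| copies of +Θ_b). -/
def qpProc (A B : Finset S.State) (r : S.State) (Ib : Finset S.State) (q : ℕ) (p : ℤ) :
    S.Proc :=
  if 0 ≤ p then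
    (S.addCopies (S.copies A (q - 1)) Ib p.toNat, S.addCopies (S.copies B (q - 1)) {r} p.toNat)
  else
    (S.addCopies (S.copies A (q - 1)) {r} (-p).toNat, S.addCopies (S.copies B (q - 1)) Ib (-p).toNat)

/-- L_α = { p/q : q > 0, qα − pΘ_b is natural }. -/
def LSet (A B : Finset S.State) (r : S.State) (Ib : Finset S.State) : Set ℚ :=
  { x | ∃ (p : ℤ) (q : ℕ), 0 < q ∧ x = (p : ℚ) / (q : ℚ) ∧
      S.Arrow (S.qpProc A B r Ib q p).1 (S.qpProc A B r Ib q p).2 }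

/-- U_α = { p/q : q > 0, pΘ_b − qα is natural }. -/
def USet (A B : Finset S.State) (r : S.State) (Ib : Finset S.State) : Set ℚ :=
  { x | ∃ (p : ℤ) (q : ℕ), 0 < q ∧ x = (p : ℚ) / (q : ℚ) ∧
      S.Arrow (S.qpProc A B r Ib q p).2 (S.qpProc A B r Ib q p).1 }

/-- The irreversibility value 𝕀(α) := sup L_α, via the Dedekind-cut construction. -/
noncomputable def IrrFn (r : S.State) (Ib : Finset S.State) (pr : S.Proc) : ℝ :=
  sSup ((fun x : ℚ => (x : ℝ)) '' S.LSet pr.1 pr.2 r Ib)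

end EidoSys

section AbstractCore

variable {M : Type} [AddCommMonoid M] [PartialOrder M]

/-- An information scale on an ordered commutative monoid: `i m` plays the role of an
information state with `m` elements, and the stability axiom holds relative to it. -/
structure InfoScale (i : ℕ → M) : Prop where
  one : i 1 = 0
  mul : ∀ m n, 0 < m → 0 < n → i (m * n) = i m + i n
  le_iff : ∀ m n, 0 < m → 0 < n → (i m ≤ i n ↔ m ≤ n)
  stable : ∀ (x y : M) (k : ℕ), 0 < k → (∀ N : ℕ, ∃ n ≥ N, n • x ≤ n • y + i k) → x ≤ y

variable {i : ℕ → M}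

theorem InfoScale.pow (h : InfoScale i) {m : ℕ} (hm : 0 < m) (k : ℕ) : i (m ^ k) = k • i m := by
  induction k with
  | zero => simp [h.one]
  | succ k ih => rw [pow_succ, h.mul _ _ (by positivity) hm, ih, succ_nsmul]

theorem InfoScale.nonneg (h : InfoScale i) {m : ℕ} (hm : 0 < m) : 0 ≤ i m := by
  rw [← h.one, h.le_iff _ _ one_pos hm]; exact hm

variable [IsOrderedAddMonoid M]

theorem InfoScale.of_ratio_le (h : InfoScale i) {x y : M} {m n m' n' : ℕ}
    (hm : 0 < m) (hn : 0 < n) (hm' : 0 < m') (hn' : 0 < n')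
    (hxy : x + i m ≤ y + i n) (hr : m' * n ≤ n' * m) : x + i m' ≤ y + i n' := by
  have hcat : (x + i m') + i n ≤ (y + i n') + i n := calc
    (x + i m') + i n = x + i (m' * n) := by rw [h.mul _ _ hm' hn, add_assoc]
    _ ≤ x + i (n' * m) := by
      gcongr
      exact (h.le_iff _ _ (by positivity) (by positivity)).2 hr
    _ = (x + i m) + i n' := by rw [h.mul _ _ hn' hm]; abel
    _ ≤ (y + i n) + i n' := by gcongr
    _ = (y + i n') + i n := by abel
  refine h.stable _ _ n hn fun t => ⟨t, le_rfl, ?_⟩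
  refine (le_add_of_nonneg_right (h.nonneg hn)).trans ?_
  induction t with
  | zero => simp
  | succ t ih =>
    calc (t + 1) • (x + i m') + i n = t • (x + i m') + ((x + i m') + i n) := by
          rw [succ_nsmul]; abel
      _ ≤ t • (x + i m') + ((y + i n') + i n) := by gcongr
      _ = (t • (x + i m') + i n) + (y + i n') := by abel
      _ ≤ (t • (y + i n') + i n) + (y + i n') := by gcongr
      _ = (t + 1) • (y + i n') + i n := by rw [succ_nsmul]; abel

theorem InfoScale.of_nsmul_le (h : InfoScale i) {x y : M} {t : ℕ} (ht : 0 < t)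
    (hxy : t • x ≤ t • y) : x ≤ y := by
  refine h.stable _ _ 1 one_pos fun N => ⟨N * t, Nat.le_mul_of_pos_right _ ht, ?_⟩
  rw [h.one, add_zero, mul_nsmul', mul_nsmul']
  exact nsmul_le_nsmul_right hxy N

theorem mul_le_mul_iff_logb_add_le {a b c d : ℕ} (ha : 0 < a) (hb : 0 < b) (hc : 0 < c)
    (hd : 0 < d) : a * b ≤ c * d ↔
      Real.logb 2 a + Real.logb 2 b ≤ Real.logb 2 c + Real.logb 2 d := by
  rw [← Real.logb_mul (by positivity) (by positivity), ← Real.logb_mul (by positivity)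
    (by positivity), Real.logb_le_logb (by norm_num) (by positivity) (by positivity)]
  exact_mod_cast Iff.rfl

theorem cast_toNat_sub_neg_toNat (p : ℤ) : ((p.toNat : ℝ)) - ((-p).toNat : ℝ) = p := by
  exact_mod_cast Int.toNat_sub_toNat_neg p

/-- The lower set of the Dedekind cut of `u` against `v`. -/
def scaleCut (i : ℕ → M) (u v : M) : Set ℚ :=
  { x | ∃ (p : ℤ) (q : ℕ), 0 < q ∧ x = (p : ℚ) / (q : ℚ) ∧
      q • u + i (2 ^ p.toNat) ≤ q • v + i (2 ^ (-p).toNat) }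

theorem InfoScale.le_of_mem_scaleCut (h : InfoScale i) {u v : M} {p : ℤ} {q : ℕ} (hq : 0 < q)
    {x : ℚ} (hx : x ∈ scaleCut i u v) (hlt : (p : ℚ) / q ≤ x) :
    q • u + i (2 ^ p.toNat) ≤ q • v + i (2 ^ (-p).toNat) := by
  obtain ⟨p', q', hq', rfl, hle⟩ := hx
  refine h.of_nsmul_le hq' ?_
  have hle' := nsmul_le_nsmul_right hle q
  simp only [nsmul_add, ← h.pow (Nat.pow_pos two_pos), ← pow_mul] at hle' ⊢
  rw [smul_comm q' q u, smul_comm q' q v]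
  refine h.of_ratio_le (by positivity) (by positivity) (by positivity) (by positivity) hle' ?_
  rw [← pow_add, ← pow_add]
  refine Nat.pow_le_pow_right two_pos ?_
  rw [div_le_div_iff₀ (by positivity) (by positivity)] at hlt
  have hint : p * q' ≤ p' * q := by exact_mod_cast hlt
  have hp := Int.toNat_sub_toNat_neg p
  have hp' := Int.toNat_sub_toNat_neg p'
  zify
  nlinarith

theorem InfoScale.scaleCut_nonempty (h : InfoScale i) {u v : M} {k : ℕ} (hk : 0 < k)
    (huv : u ≤ v + i k) : (scaleCut i u v).Nonempty := by
  refine ⟨_, -(k : ℤ), 1, one_pos, rfl, ?_⟩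
  have h0 : (-(k : ℤ)).toNat = 0 := by simp
  have hle : i k ≤ i (2 ^ k) := (h.le_iff _ _ hk (by positivity)).2 k.lt_two_pow_self.le
  rw [h0, neg_neg, Int.toNat_natCast, pow_zero, h.one, add_zero, one_nsmul, one_nsmul]
  exact huv.trans (by gcongr)

theorem InfoScale.bddAbove_scaleCut (h : InfoScale i) {u v : M}
    (hcancel : ∀ x y, u + x ≤ u + y → x ≤ y) {l : ℕ} (hl : 0 < l) (hvu : v ≤ u + i l) :
    BddAbove ((fun x : ℚ => (x : ℝ)) '' scaleCut i u v) := by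
  refine ⟨Real.logb 2 l, ?_⟩
  rintro _ ⟨_, ⟨p, q, hq, rfl, hle⟩, rfl⟩
  have hcancel' : ∀ (t : ℕ) (x y : M), t • u + x ≤ t • u + y → x ≤ y := by
    intro t
    induction t with
    | zero => simp
    | succ t ih =>
      intro x y hxy
      rw [succ_nsmul', add_assoc, add_assoc] at hxy
      exact ih _ _ (hcancel _ _ hxy)
  have hnat : 2 ^ p.toNat * 1 ≤ l ^ q * 2 ^ (-p).toNat := by
    rw [mul_one, ← h.le_iff _ _ (by positivity) (by positivity),
      h.mul _ _ (by positivity) (by positivity), h.pow hl]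
    refine hcancel' q _ _ (hle.trans ?_)
    rw [← add_assoc, ← nsmul_add]
    gcongr
  rw [mul_le_mul_iff_logb_add_le (by positivity) one_pos (by positivity) (by positivity)] at hnat
  push_cast at hnat ⊢
  simp only [Real.logb_pow, Real.logb_self_eq_one one_lt_two, Real.logb_one] at hnat
  have hp := cast_toNat_sub_neg_toNat p
  rw [div_le_iff₀ (by positivity)]
  linarith

theorem InfoScale.le_iff_sSup_scaleCut (h : InfoScale i) {u v : M}
    (hcancel : ∀ x y, u + x ≤ u + y → x ≤ y) {k l : ℕ} (hk : 0 < k) (hl : 0 < l)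
    (huv : u ≤ v + i k) (hvu : v ≤ u + i l) {m n : ℕ} (hm : 0 < m) (hn : 0 < n) :
    u + i m ≤ v + i n ↔ 0 ≤ sSup ((fun x : ℚ => (x : ℝ)) '' scaleCut i u v) +
      (Real.logb 2 n - Real.logb 2 m) := by
  set y := Real.logb 2 m - Real.logb 2 n with hy
  set L := (fun x : ℚ => (x : ℝ)) '' scaleCut i u v with hL
  have hbdd : BddAbove L := h.bddAbove_scaleCut hcancel hl hvu
  have hne : L.Nonempty := (h.scaleCut_nonempty hk huv).image _
  have hiff : 0 ≤ sSup L + (Real.logb 2 n - Real.logb 2 m) ↔ y ≤ sSup L := by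
    constructor <;> intro <;> linarith
  rw [hiff]
  constructor
  · intro hle
    refine le_of_forall_rat_lt_imp_le fun x hx => le_csSup hbdd ⟨x, ?_, rfl⟩
    refine ⟨x.num, x.den, x.den_pos, (Rat.num_div_den x).symm, ?_⟩
    have hle' := nsmul_le_nsmul_right hle x.den
    rw [nsmul_add, nsmul_add, ← h.pow hm, ← h.pow hn] at hle'
    refine h.of_ratio_le (by positivity) (by positivity) (by positivity) (by positivity) hle' ?_
    rw [mul_le_mul_iff_logb_add_le (by positivity) (by positivity) (by positivity)
      (by positivity)]
    push_cast
    simp only [Real.logb_pow, Real.logb_self_eq_one one_lt_two]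
    have hp := cast_toNat_sub_neg_toNat x.num
    rw [Rat.cast_def, div_lt_iff₀ (by exact_mod_cast x.den_pos)] at hx
    rw [hy] at hx
    linarith
  · intro hle
    refine h.stable _ _ 2 two_pos fun N => ⟨N + 1, by omega, ?_⟩
    obtain ⟨q, hq, hqN⟩ : ∃ q : ℕ, 0 < q ∧ q = N + 1 := ⟨N + 1, by omega, rfl⟩
    rw [← hqN]
    set p : ℤ := ⌈(q : ℝ) * y⌉ - 1 with hp
    have hqR : (0 : ℝ) < q := by exact_mod_cast hq
    have hp_lt : ((p : ℚ) / q : ℝ) < y := by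
      push_cast
      rw [div_lt_iff₀ hqR, hp]
      push_cast
      linarith [Int.ceil_lt_add_one ((q : ℝ) * y)]
    have hp_ge : (q : ℝ) * y ≤ p + 1 := by
      rw [hp]
      push_cast
      linarith [Int.le_ceil ((q : ℝ) * y)]
    obtain ⟨_, ⟨x, hx, rfl⟩, hpx⟩ := exists_lt_of_lt_csSup hne (hp_lt.trans_le hle)
    have hpx' : (p : ℚ) / q ≤ x := by
      refine (Rat.cast_lt (K := ℝ).1 ?_).le
      rw [Rat.cast_div, Rat.cast_intCast, Rat.cast_natCast]
      simpa using hpx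
    have hcut := h.le_of_mem_scaleCut hq hx hpx'
    rw [nsmul_add, nsmul_add, ← h.pow hm, ← h.pow hn, add_assoc,
      ← h.mul _ _ (by positivity) two_pos]
    refine h.of_ratio_le (by positivity) (by positivity) (by positivity) (by positivity) hcut ?_
    rw [mul_le_mul_iff_logb_add_le (by positivity) (by positivity) (by positivity)
      (by positivity)]
    push_cast
    rw [Real.logb_mul (by positivity) (by positivity)]
    simp only [Real.logb_pow, Real.logb_self_eq_one one_lt_two]
    have hps := cast_toNat_sub_neg_toNat p
    rw [hy] at hp_ge
    linarith

end AbstractCore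

namespace EidoSys

variable (S : EidoSys)

/-- The eidostates of the system, preordered by `Arrow`. -/
@[ext]
structure EidoState where
  carrier : Finset S.State
  mem : carrier ∈ S.Eido

instance : Preorder S.EidoState where
  le A B := S.Arrow A.1 B.1
  le_refl A := S.arrow_of_sim _ _ A.2 A.2 (S.sim_refl _)
  le_trans _ _ _ := S.arrow_trans _ _ _

instance : Add S.EidoState := ⟨fun A B => ⟨S.comb A.1 B.1, (S.comb_mem _ _).2 ⟨A.2, B.2⟩⟩⟩

/-- Eidostates up to `Rev`. -/
abbrev EidoClass : Type := Antisymmetrization S.EidoState (· ≤ ·)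

variable {S}

theorem EidoState.le_of_sim {A B : S.EidoState} (h : S.Sim A.1 B.1) : A ≤ B :=
  S.arrow_of_sim _ _ A.2 B.2 h

theorem EidoState.add_comm_le (A B : S.EidoState) : A + B ≤ B + A :=
  le_of_sim (S.sim_comm _ _)

theorem EidoState.add_le_add_right' {A B : S.EidoState} (h : A ≤ B) (C : S.EidoState) :
    A + C ≤ B + C :=
  S.arrow_comb _ _ _ h

theorem EidoState.add_le_add' {A B C D : S.EidoState} (h : A ≤ B) (h' : C ≤ D) :
    A + C ≤ B + D :=
  (add_le_add_right' h C).trans <| (add_comm_le B C).trans <|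
    (add_le_add_right' h' B).trans (add_comm_le D B)

/-- The class of an eidostate. -/
def cls (A : S.EidoState) : S.EidoClass := toAntisymmetrization (· ≤ ·) A

theorem cls_le_cls {A B : S.EidoState} : cls A ≤ cls B ↔ S.Arrow A.1 B.1 := Iff.rfl

instance : Add S.EidoClass :=
  ⟨Quotient.map₂ (· + ·) fun _ _ h _ _ h' =>
    ⟨EidoState.add_le_add' h.1 h'.1, EidoState.add_le_add' h.2 h'.2⟩⟩

theorem cls_add (A B : S.EidoState) : cls (A + B) = cls A + cls B := rfl

instance : AddCommSemigroup S.EidoClass where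
  add_assoc := by
    rintro ⟨A⟩ ⟨B⟩ ⟨C⟩
    exact Quotient.sound ⟨EidoState.le_of_sim (S.sim_assoc _ _ _),
      EidoState.le_of_sim (S.sim_symm _ _ (S.sim_assoc _ _ _))⟩
  add_comm := by
    rintro ⟨A⟩ ⟨B⟩
    exact Quotient.sound ⟨EidoState.add_comm_le A B, EidoState.add_comm_le B A⟩

/-- The class of a singleton. -/
def pt (a : S.State) : S.EidoClass := cls ⟨{a}, S.singleton_mem a⟩

theorem EidoClass.add_le_add_right' {x y : S.EidoClass} (h : x ≤ y) (z : S.EidoClass) :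
    x + z ≤ y + z := by
  induction x, y using Quotient.inductionOn₂ with | _ A B
  induction z using Quotient.inductionOn with | _ C
  exact EidoState.add_le_add_right' h C

theorem EidoClass.le_of_add_pt_le {x y : S.EidoClass} {a : S.State} (h : x + pt a ≤ y + pt a) :
    x ≤ y := by
  induction x, y using Quotient.inductionOn₂ with | _ A B
  exact S.arrow_cancel _ _ a h

theorem IsRecord.add_pt {r : S.State} (hr : S.IsRecord r) (x : S.EidoClass) : x + pt r = x := by
  obtain ⟨a, h₁, h₂⟩ := hr
  have ha : pt a = pt a + pt r := le_antisymm h₁ h₂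
  have hx : (x + pt r) + pt a = x + pt a := by
    conv_rhs => rw [ha]
    rw [add_assoc, add_comm (pt r)]
  exact le_antisymm (EidoClass.le_of_add_pt_le hx.le) (EidoClass.le_of_add_pt_le hx.ge)

theorem IsRecord.pt_eq {r s : S.State} (hr : S.IsRecord r) (hs : S.IsRecord s) :
    pt r = pt s := by
  rw [← hs.add_pt (pt r), add_comm, hr.add_pt]

theorem IsRecord.arrow {r s : S.State} (hr : S.IsRecord r) (hs : S.IsRecord s) :
    S.Arrow {r} {s} :=
  cls_le_cls.1 (hr.pt_eq hs).le

/-- The classes form a commutative monoid whose zero is the class of a record state. -/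
abbrev classMonoid {r : S.State} (hr : S.IsRecord r) : AddCommMonoid S.EidoClass :=
  { (inferInstance : AddCommSemigroup S.EidoClass) with
    zero := pt r
    add_zero := hr.add_pt
    zero_add := fun x => by rw [add_comm]; exact hr.add_pt x
    nsmul := @nsmulRec _ ⟨pt r⟩ _ }

theorem comb_singleton (a b : S.State) : S.comb {a} {b} = {S.pair a b} := by simp [comb]

theorem card_comb (A B : Finset S.State) : (S.comb A B).card = A.card * B.card :=
  Finset.card_image₂_iff.2 fun _ _ _ _ h => Prod.ext_iff.2 (S.pair_inj _ _ _ _ h)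

theorem IsRecord.pair {r s : S.State} (hr : S.IsRecord r) (hs : S.IsRecord s) :
    S.IsRecord (S.pair r s) := by
  have hrs : pt r = pt r + pt (S.pair r s) := by
    have : pt (S.pair r s) = pt r + pt s := by
      unfold pt
      rw [← cls_add]
      exact congrArg cls (EidoState.ext (comb_singleton r s).symm)
    rw [this, hs.add_pt, hr.add_pt]
  exact ⟨r, cls_le_cls.1 hrs.le, cls_le_cls.1 hrs.ge⟩

theorem IsInfo.mem {I : Finset S.State} (hI : S.IsInfo I) : I ∈ S.Eido := hI.1

theorem IsBit.isInfo {I : Finset S.State} (hI : S.IsBit I) : S.IsInfo I := hI.1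

theorem IsRecord.isInfo_singleton {r : S.State} (hr : S.IsRecord r) : S.IsInfo {r} :=
  ⟨S.singleton_mem r, by simpa using hr⟩

theorem IsInfo.comb {I J : Finset S.State} (hI : S.IsInfo I) (hJ : S.IsInfo J) :
    S.IsInfo (S.comb I J) := by
  refine ⟨(S.comb_mem _ _).2 ⟨hI.mem, hJ.mem⟩, fun x hx => ?_⟩
  obtain ⟨r, hr, s, hs, rfl⟩ := Finset.mem_image₂.1 hx
  exact (hI.2 r hr).pair (hJ.2 s hs)

theorem IsInfo.mono {I J : Finset S.State} (hI : S.IsInfo I) (hJI : J ⊆ I) (hJ : J.Nonempty) :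
    S.IsInfo J :=
  ⟨S.subset_mem _ _ hI.mem hJI hJ, fun r hr => hI.2 r (hJI hr)⟩

theorem IsInfo.nonempty {I : Finset S.State} (hI : S.IsInfo I) : I.Nonempty :=
  S.eido_nonempty _ hI.mem

theorem IsInfo.card_pos {I : Finset S.State} (hI : S.IsInfo I) : 0 < I.card :=
  hI.nonempty.card_pos

theorem IsInfo.arrow_union {I₁ I₂ J₁ J₂ : Finset S.State} (hI₁ : S.IsInfo I₁) (hI₂ : S.IsInfo I₂)
    (hJ₁ : S.IsInfo J₁) (hJ₂ : S.IsInfo J₂) (hI : Disjoint I₁ I₂) (hJ : Disjoint J₁ J₂)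
    (h₁ : S.Arrow I₁ J₁) (h₂ : S.Arrow I₂ J₂) : S.Arrow (I₁ ∪ I₂) (J₁ ∪ J₂) := by
  have hrec : ∀ {A B : Finset S.State}, S.IsInfo A → S.IsInfo B → ∀ x ∈ A ∪ B, S.IsRecord x :=
    fun hA hB x hx => (Finset.mem_union.1 hx).elim (hA.2 x) (hB.2 x)
  exact S.arrow_union _ _ _ _ hI₁.mem hI₂.mem hJ₁.mem hJ₂.mem hI hJ
    (fun x hx y hy => .inl ((hrec hI₁ hI₂ x hx).arrow (hrec hI₁ hI₂ y hy)))
    (fun x hx y hy => .inl ((hrec hJ₁ hJ₂ x hx).arrow (hrec hJ₁ hJ₂ y hy))) h₁ h₂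

theorem IsBit.arrow_of_pos {r : S.State} {Ib : Finset S.State} (hr : S.IsRecord r)
    (hb : S.IsBit Ib) (hΘ : S.Pos {r} Ib) : S.Arrow {r} Ib := by
  refine hΘ.resolve_right fun h => ?_
  obtain ⟨s, hs⟩ := hb.isInfo.nonempty
  refine S.arrow_nsubset Ib {s} hb.isInfo.mem (S.singleton_mem s) ?_
    (S.arrow_trans _ _ _ h (hr.arrow (hb.isInfo.2 s hs)))
  exact LE.le.ssubset_of_ne (by simpa using hs) fun h => by
    simpa [← h] using hb.2

theorem IsInfo.singleton_arrow {r : S.State} {Ib : Finset S.State} (hr : S.IsRecord r)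
    (hb : S.IsBit Ib) (hΘ : S.Pos {r} Ib) {s : S.State} (hs : S.IsRecord s)
    {K : Finset S.State} (hK : S.IsInfo K) : S.Arrow {s} K := by
  have hsplit := hb.arrow_of_pos hr hΘ
  obtain ⟨x, y, hxy, rfl⟩ := Finset.card_eq_two.1 hb.2
  have hx : S.IsRecord x := hb.isInfo.2 x (by simp)
  have hy : S.IsRecord y := hb.isInfo.2 y (by simp)
  have hne := hK.nonempty
  induction hne using Finset.Nonempty.cons_induction with
  | singleton k => exact hs.arrow (hK.2 k (by simp))
  | cons k K hk hKne ih =>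
    rw [Finset.cons_eq_insert] at hK ⊢
    have hK' : S.IsInfo K := hK.mono (Finset.subset_insert _ _) hKne
    have hkr : S.IsRecord k := hK.2 k (by simp)
    have hy' : S.Arrow {y} K := S.arrow_trans _ _ _ (hy.arrow hs) (ih hK')
    have hu := hx.isInfo_singleton.arrow_union hy.isInfo_singleton hkr.isInfo_singleton hK'
      (by simpa using hxy) (by simpa using hk) (hx.arrow hkr) hy'
    exact S.arrow_trans _ _ _ (hs.arrow hr) (S.arrow_trans _ _ _ hsplit hu)

theorem IsInfo.arrow_of_card_le {r : S.State} {Ib : Finset S.State} (hr : S.IsRecord r)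
    (hb : S.IsBit Ib) (hΘ : S.Pos {r} Ib) {I J : Finset S.State} (hI : S.IsInfo I)
    (hJ : S.IsInfo J) (hIJ : I.card ≤ J.card) : S.Arrow I J := by
  have hne := hI.nonempty
  induction hne using Finset.Nonempty.cons_induction generalizing J with
  | singleton k => exact singleton_arrow hr hb hΘ (hI.2 k (by simp)) hJ
  | cons k K hk hKne ih =>
    rw [Finset.card_cons] at hIJ
    rw [Finset.cons_eq_insert] at hI ⊢
    obtain ⟨j, hj⟩ := hJ.nonempty
    have hcard := Finset.card_erase_add_one hj
    have hKpos := hKne.card_pos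
    have hJ' : S.IsInfo (J.erase j) :=
      hJ.mono (Finset.erase_subset _ _) (Finset.card_pos.1 (by omega))
    have hK' : S.IsInfo K := hI.mono (Finset.subset_insert _ _) hKne
    have hkr : S.IsRecord k := hI.2 k (by simp)
    have hjr : S.IsRecord j := hJ.2 j hj
    have hu := hkr.isInfo_singleton.arrow_union hK' hjr.isInfo_singleton hJ'
      (by simpa using hk) (by simp) (hkr.arrow hjr) (ih hK' hJ' (by omega))
    rw [← Finset.insert_erase hj]
    exact hu

theorem IsInfo.arrow_iff {r : S.State} {Ib : Finset S.State} (hr : S.IsRecord r)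
    (hb : S.IsBit Ib) (hΘ : S.Pos {r} Ib) {I J : Finset S.State} (hI : S.IsInfo I)
    (hJ : S.IsInfo J) : S.Arrow I J ↔ I.card ≤ J.card := by
  refine ⟨fun h => ?_, hI.arrow_of_card_le hr hb hΘ hJ⟩
  by_contra! hlt
  obtain ⟨K, hKI, hK⟩ := Finset.exists_subset_card_eq hlt.le
  have hK' : S.IsInfo K := hI.mono hKI (Finset.card_pos.1 (hK ▸ hJ.card_pos))
  exact S.arrow_nsubset I K hI.mem hK'.mem
    (LE.le.ssubset_of_ne hKI fun h => by rw [← h, hK] at hlt; exact hlt.false)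
    (S.arrow_trans _ _ _ h (hJ.arrow_of_card_le hr hb hΘ hK' hK.ge))

theorem IsBit.exists_isInfo_card {Ib : Finset S.State} (hb : S.IsBit Ib) {m : ℕ} (hm : 0 < m) :
    ∃ I, S.IsInfo I ∧ I.card = m := by
  have hlarge : ∀ k, ∃ I, S.IsInfo I ∧ k ≤ I.card := by
    intro k
    induction k with
    | zero => exact ⟨Ib, hb.isInfo, Nat.zero_le _⟩
    | succ k ih =>
      obtain ⟨I, hI, hk⟩ := ih
      refine ⟨S.comb I Ib, hI.comb hb.isInfo, ?_⟩
      have := hI.card_pos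
      rw [card_comb, hb.2]
      omega
  obtain ⟨I, hI, hk⟩ := hlarge m
  obtain ⟨K, hKI, hK⟩ := Finset.exists_subset_card_eq hk
  exact ⟨K, hI.mono hKI (Finset.card_pos.1 (hK ▸ hm)), hK⟩

open Classical in
/-- The class of the information states with `m` elements. -/
noncomputable def infoClass (r : S.State) (m : ℕ) : S.EidoClass :=
  if h : ∃ I, S.IsInfo I ∧ I.card = m then cls ⟨h.choose, h.choose_spec.1.mem⟩ else pt r

theorem IsInfo.infoClass_card {r : S.State} {Ib : Finset S.State} (hr : S.IsRecord r)
    (hb : S.IsBit Ib) (hΘ : S.Pos {r} Ib) {I : Finset S.State} (hI : S.IsInfo I) :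
    infoClass r I.card = cls ⟨I, hI.mem⟩ := by
  have h : ∃ K, S.IsInfo K ∧ K.card = I.card := ⟨I, hI, rfl⟩
  rw [infoClass, dif_pos h]
  refine le_antisymm (cls_le_cls.2 ?_) (cls_le_cls.2 ?_)
  · exact h.choose_spec.1.arrow_of_card_le hr hb hΘ hI h.choose_spec.2.le
  · exact hI.arrow_of_card_le hr hb hΘ h.choose_spec.1 h.choose_spec.2.ge

theorem copies_mem {A : Finset S.State} (hA : A ∈ S.Eido) (n : ℕ) : S.copies A n ∈ S.Eido := by
  induction n with
  | zero => exact hA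
  | succ n ih => exact (S.comb_mem _ _).2 ⟨hA, ih⟩

theorem addCopies_mem {A B : Finset S.State} (hA : A ∈ S.Eido) (hB : B ∈ S.Eido) (n : ℕ) :
    S.addCopies A B n ∈ S.Eido := by
  induction n with
  | zero => exact hA
  | succ n ih => exact (S.comb_mem _ _).2 ⟨ih, hB⟩

theorem cls_copies {r : S.State} (hr : S.IsRecord r) {A : Finset S.State} (hA : A ∈ S.Eido)
    (n : ℕ) : letI := classMonoid hr
    cls ⟨S.copies A n, copies_mem hA n⟩ = (n + 1) • cls ⟨A, hA⟩ := by
  let := classMonoid hr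
  induction n with
  | zero => exact (one_nsmul _).symm
  | succ n ih =>
    change _ = (n + 1 + 1) • cls (S := S) ⟨A, hA⟩
    rw [succ_nsmul', ← ih]
    rfl

theorem cls_addCopies {r : S.State} (hr : S.IsRecord r) {A B : Finset S.State} (hA : A ∈ S.Eido)
    (hB : B ∈ S.Eido) (n : ℕ) : letI := classMonoid hr
    cls ⟨S.addCopies A B n, addCopies_mem hA hB n⟩ = cls ⟨A, hA⟩ + n • cls ⟨B, hB⟩ := by
  let := classMonoid hr
  induction n with
  | zero =>
    change _ = _ + 0 • cls (S := S) ⟨B, hB⟩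
    rw [zero_nsmul, add_zero]
    rfl
  | succ n ih =>
    change _ = _ + (n + 1) • cls (S := S) ⟨B, hB⟩
    rw [succ_nsmul, ← add_assoc, ← ih]
    rfl

theorem isOrderedAddMonoid_classMonoid {r : S.State} (hr : S.IsRecord r) :
    letI := classMonoid hr
    IsOrderedAddMonoid S.EidoClass :=
  letI := classMonoid hr
  { add_le_add_left := fun _ _ h z => EidoClass.add_le_add_right' h z }

theorem infoScale_infoClass (hstab : S.StabilityAxiom) {r : S.State} {Ib : Finset S.State}
    (hr : S.IsRecord r) (hb : S.IsBit Ib) (hΘ : S.Pos {r} Ib) :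
    letI := classMonoid hr
    InfoScale (infoClass (S := S) r) := by
  let := classMonoid hr
  refine ⟨?_, fun m n hm hn => ?_, fun m n hm hn => ?_, fun x y k hk hxy => ?_⟩
  · have h := hr.isInfo_singleton.infoClass_card hr hb hΘ
    rwa [Finset.card_singleton] at h
  · obtain ⟨I, hI, rfl⟩ := hb.exists_isInfo_card hm
    obtain ⟨J, hJ, rfl⟩ := hb.exists_isInfo_card hn
    rw [← card_comb, (hI.comb hJ).infoClass_card hr hb hΘ, hI.infoClass_card hr hb hΘ,
      hJ.infoClass_card hr hb hΘ]
    rfl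
  · obtain ⟨I, hI, rfl⟩ := hb.exists_isInfo_card hm
    obtain ⟨J, hJ, rfl⟩ := hb.exists_isInfo_card hn
    rw [hI.infoClass_card hr hb hΘ, hJ.infoClass_card hr hb hΘ]
    exact hI.arrow_iff hr hb hΘ hJ
  · obtain ⟨K, hK, rfl⟩ := hb.exists_isInfo_card hk
    rw [hK.infoClass_card hr hb hΘ] at hxy
    induction x, y using Quotient.inductionOn₂ with | _ A B
    refine hstab A.1 B.1 K A.2 B.2 hK fun N => ?_
    obtain ⟨n, hn, hle⟩ := hxy (N + 1)
    obtain ⟨n, rfl⟩ : ∃ t, n = t + 1 := ⟨n - 1, by omega⟩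
    refine ⟨n, by omega, ?_⟩
    change (n + 1) • cls A ≤ (n + 1) • cls B + _ at hle
    rw [← cls_copies hr A.2, ← cls_copies hr B.2] at hle
    exact hle

theorem scaleCut_infoClass {r : S.State} {Ib : Finset S.State} (hstab : S.StabilityAxiom)
    (hr : S.IsRecord r) (hb : S.IsBit Ib) (hΘ : S.Pos {r} Ib) (a b : S.State) :
    letI := classMonoid hr
    S.LSet {a} {b} r Ib = scaleCut (infoClass r) (pt a) (pt b) := by
  let := classMonoid hr
  have hs := infoScale_infoClass hstab hr hb hΘ
  have hbit : infoClass r 2 = cls ⟨Ib, hb.isInfo.mem⟩ := by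
    rw [← hb.isInfo.infoClass_card hr hb hΘ, hb.2]
  have hzero : cls ⟨{r}, S.singleton_mem r⟩ = (0 : S.EidoClass) := rfl
  ext x
  refine exists_congr fun p => exists_congr fun q => and_congr_right fun hq =>
    and_congr_right fun _ => ?_
  obtain ⟨q, rfl⟩ : ∃ t, q = t + 1 := ⟨q - 1, by omega⟩
  have hcopies : ∀ (c d : S.State) {B C : Finset S.State} (hB : B ∈ S.Eido) (hC : C ∈ S.Eido)
      (n : ℕ), S.Arrow (S.addCopies (S.copies {c} q) B n) (S.addCopies (S.copies {d} q) C n) ↔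
        (q + 1) • pt c + n • cls ⟨B, hB⟩ ≤ (q + 1) • pt d + n • cls ⟨C, hC⟩ := by
    intro c d B C hB hC n
    have hc := copies_mem (S.singleton_mem c) q
    have hd := copies_mem (S.singleton_mem d) q
    rw [← cls_le_cls (A := ⟨_, addCopies_mem hc hB n⟩) (B := ⟨_, addCopies_mem hd hC n⟩),
      cls_addCopies hr hc, cls_addCopies hr hd, cls_copies hr, cls_copies hr]
    rfl
  rw [hs.pow two_pos, hs.pow two_pos, hbit, qpProc, Nat.add_sub_cancel]
  split_ifs with hp
  · rw [hcopies a b hb.isInfo.mem (S.singleton_mem r), hzero, Int.toNat_of_nonpos (neg_nonpos.2 hp),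
      zero_nsmul, nsmul_zero]
  · rw [hcopies a b (S.singleton_mem r) hb.isInfo.mem, hzero, Int.toNat_of_nonpos (by omega : p ≤ 0),
      zero_nsmul, nsmul_zero]

theorem DemonAxiom.exists_infoClass (hdemon : S.DemonAxiom) {r : S.State} {Ib : Finset S.State}
    (hr : S.IsRecord r) (hb : S.IsBit Ib) (hΘ : S.Pos {r} Ib) {a b : S.State}
    (hab : S.Arrow {a} {b}) :
    (∃ k, 0 < k ∧ pt a ≤ pt b + infoClass r k) ∧ ∃ k, 0 < k ∧ pt b ≤ pt a + infoClass r k := by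
  have hle : pt a ≤ pt b + pt r := by
    rw [hr.add_pt]
    exact hab
  obtain ⟨I, hI, hle'⟩ := (hdemon a b {r} hr.isInfo_singleton hle).1
  refine ⟨⟨Finset.card {r}, by simp, ?_⟩, ⟨I.card, hI.card_pos, ?_⟩⟩
  · rw [hr.isInfo_singleton.infoClass_card hr hb hΘ]
    exact hle
  · rw [hI.infoClass_card hr hb hΘ]
    exact hle'

end EidoSys

/-- For a possible singleton process α = ({a},{b}) with irreversibility value
𝕀(α) (Dedekind-cut construction relative to the bit process Θ_b = ({r}, Ib)) and an
information process Γ = (I, J) with 𝕀(Γ) = log₂|J| − log₂|I|, the combined process α + Γ is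
natural iff 𝕀(α) + 𝕀(Γ) ≥ 0. -/
theorem stmt10 (S : EidoSys) (hinfo : S.InfoAxiom) (hdemon : S.DemonAxiom)
    (hstab : S.StabilityAxiom)
    (r : S.State) (Ib : Finset S.State) (hr : S.IsRecord r) (hb : S.IsBit Ib)
    (hΘ : S.Pos {r} Ib)
    (a b : S.State) (hab : S.Pos {a} {b})
    (I J : Finset S.State) (hI : S.IsInfo I) (hJ : S.IsInfo J) :
    S.Arrow (S.comb {a} I) (S.comb {b} J) ↔
      0 ≤ S.IrrFn r Ib ({a}, {b}) + (Real.logb 2 (J.card) - Real.logb 2 (I.card)) := by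
  let := EidoSys.classMonoid hr
  have := EidoSys.isOrderedAddMonoid_classMonoid hr
  have hscale := EidoSys.infoScale_infoClass hstab hr hb hΘ
  have hcancel : ∀ x y, EidoSys.pt a + x ≤ EidoSys.pt a + y → x ≤ y := fun x y h => by
    rw [add_comm _ x, add_comm _ y] at h
    exact EidoSys.EidoClass.le_of_add_pt_le h
  obtain ⟨⟨k, hk, hak⟩, l, hl, hbl⟩ :
      (∃ k, 0 < k ∧ EidoSys.pt a ≤ EidoSys.pt b + EidoSys.infoClass r k) ∧
        ∃ k, 0 < k ∧ EidoSys.pt b ≤ EidoSys.pt a + EidoSys.infoClass r k := by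
    rcases hab with hab | hab
    · exact hdemon.exists_infoClass hr hb hΘ hab
    · exact (hdemon.exists_infoClass hr hb hΘ hab).symm
  have hmain := hscale.le_iff_sSup_scaleCut hcancel hk hl hak hbl hI.card_pos hJ.card_pos
  rw [hI.infoClass_card hr hb hΘ, hJ.infoClass_card hr hb hΘ,
    ← EidoSys.scaleCut_infoClass hstab hr hb hΘ] at hmain
  exact hmain
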